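/- arXiv:2308.15884 — 5 statements merged into one kernel-verified Lean document; each statement's English description precedes it below -/
import Mathlib

section
/- Let λ be a partition of n with at most d parts (equivalently, a Young diagram with n cells and at most d rows). Then the number of semistandard Young tableaux of shape λ with all entries in {0, 1, …, d−1} is at most (n+1)^{d(d−1)/2}. -/
namespace SemistandardYoungTableau

variable {μ : YoungDiagram}

theorem row_index_le (T : SemistandardYoungTableau μ) {i j : ℕ} (h : (i, j) ∈ μ) : i ≤ T i j := by
  induction i with
  | zero => exact Nat.zero_le _
  | succ i ih =>
    exact (ih (μ.up_left_mem (Nat.le_succ i) le_rfl h)).trans_lt (T.col_strict (Nat.lt_succ_self i) h)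

/-- The columns of the cells in row `i` whose entry is less than `k`. -/
def colsLT (T : SemistandardYoungTableau μ) (i k : ℕ) : Finset ℕ :=
  {j ∈ Finset.range (μ.rowLen i) | T i j < k}

theorem mem_colsLT (T : SemistandardYoungTableau μ) {i j k : ℕ} :
    j ∈ T.colsLT i k ↔ (i, j) ∈ μ ∧ T i j < k := by
  simp [colsLT, YoungDiagram.mem_iff_lt_rowLen]

theorem isLowerSet_colsLT (T : SemistandardYoungTableau μ) (i k : ℕ) :
    IsLowerSet (T.colsLT i k : Set ℕ) := by
  intro a b hba ha
  rw [Finset.mem_coe, mem_colsLT] at ha ⊢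
  exact ⟨μ.up_left_mem le_rfl hba ha.1, (T.row_weak_of_le hba ha.1).trans_lt ha.2⟩

theorem card_colsLT_le (T : SemistandardYoungTableau μ) (i k : ℕ) :
    (T.colsLT i k).card ≤ μ.card := by
  calc (T.colsLT i k).card ≤ μ.rowLen i := by
        simpa [colsLT] using Finset.card_filter_le (Finset.range (μ.rowLen i)) (T i · < k)
    _ = (μ.row i).card := μ.rowLen_eq_card
    _ ≤ μ.card := Finset.card_le_card (Finset.filter_subset _ _)

theorem colsLT_eq_of_card_eq {T T' : SemistandardYoungTableau μ} {i k : ℕ}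
    (h : (T.colsLT i k).card = (T'.colsLT i k).card) : T.colsLT i k = T'.colsLT i k := by
  rcases (T.isLowerSet_colsLT i k).total (T'.isLowerSet_colsLT i k) with hs | hs
  · exact Finset.eq_of_subset_of_card_le (Finset.coe_subset.mp hs) h.ge
  · exact (Finset.eq_of_subset_of_card_le (Finset.coe_subset.mp hs) h.le).symm

theorem eq_of_card_colsLT_eq {d : ℕ} {T T' : SemistandardYoungTableau μ}
    (hT : ∀ i j, (i, j) ∈ μ.cells → T i j < d) (hT' : ∀ i j, (i, j) ∈ μ.cells → T' i j < d)
    (h : ∀ i k, i < k → k < d → (T.colsLT i k).card = (T'.colsLT i k).card) : T = T' := by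
  ext i j
  by_cases hij : (i, j) ∈ μ
  · refine eq_of_forall_gt_iff fun k => ?_
    have h₁ := hT i j hij
    have h₂ := hT' i j hij
    have h₃ := T.row_index_le hij
    have h₄ := T'.row_index_le hij
    by_cases hk : i < k ∧ k < d
    · have := Finset.ext_iff.mp (colsLT_eq_of_card_eq (h i k hk.1 hk.2)) j
      simpa [mem_colsLT, hij] using this
    · omega
  · rw [T.zeros hij, T'.zeros hij]

end SemistandardYoungTableau


/-- If `μ` is a Young diagram with `n` cells and at most `d` rows, then the number of
semistandard Young tableaux of shape `μ` with all entries in `{0, 1, …, d-1}` is at most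
`(n+1)^(d(d-1)/2)`. -/
theorem card_ssyt_entries_lt_d_le (n d : ℕ) (μ : YoungDiagram)
    (hcard : μ.card = n) (hrows : ∀ c ∈ μ.cells, c.1 < d) :
    Nat.card {T : SemistandardYoungTableau μ // ∀ i j, (i, j) ∈ μ.cells → T i j < d} ≤
      (n + 1) ^ (d * (d - 1) / 2) := by
  subst hcard
  let f : {T : SemistandardYoungTableau μ // ∀ i j, (i, j) ∈ μ.cells → T i j < d} →
      ((Σ k : Fin d, Fin k) → Fin (μ.card + 1)) := fun T p =>
    ⟨(T.1.colsLT p.2 p.1).card, Nat.lt_succ_of_le (T.1.card_colsLT_le _ _)⟩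
  have hf : Function.Injective f := fun T T' h =>
    Subtype.ext <| SemistandardYoungTableau.eq_of_card_colsLT_eq T.2 T'.2 fun i k hik hkd =>
      congrArg Fin.val (congrFun h ⟨⟨k, hkd⟩, ⟨i, hik⟩⟩)
  refine (Nat.card_le_card_of_injective f hf).trans_eq ?_
  simp [Fin.sum_univ_eq_sum_range (fun k => k) d, Finset.sum_range_id]
end

section
/- For d ≥ 1, the ℂ-vector space of S_n-invariant matrices indexed by (Fin n → Fin d), i.e. matrices M with M (f∘π) (g∘π) = M f g for all permutations π of Fin n and all f, g, has dimension exactly the binomial coefficient C(n + d² − 1, d² − 1). -/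
/-- The `ℂ`-subspace of `S_n`-invariant matrices indexed by `Fin n → Fin d`, i.e. the
commutant of the permutation representation of `S_n` on `(ℂ^d)^{⊗n}`. -/
noncomputable def invariantMatrices (n d : ℕ) :
    Submodule ℂ (Matrix (Fin n → Fin d) (Fin n → Fin d) ℂ) where
  carrier := {M | ∀ (π : Equiv.Perm (Fin n)) (f g : Fin n → Fin d),
    M (f ∘ π) (g ∘ π) = M f g}
  add_mem' := by
    intro M N hM hN π f g
    simp only [Matrix.add_apply, hM π f g, hN π f g]
  zero_mem' := by
    intro π f g
    simp
  smul_mem' := by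
    intro c M hM π f g
    simp only [Matrix.smul_apply, hM π f g]

/-- The unordered tuple of the values of `h : Fin n → α`. -/
def symOfFn {α : Type*} {n : ℕ} (h : Fin n → α) : Sym α n :=
  Sym.mk (Multiset.map h Finset.univ.val) (by simp)

theorem symOfFn_eq_iff {α : Type*} {n : ℕ} (h k : Fin n → α) :
    symOfFn h = symOfFn k ↔ ∃ π : Equiv.Perm (Fin n), h = k ∘ π := by
  classical
  rw [← Sym.coe_inj]
  change Multiset.map h Finset.univ.val = Multiset.map k Finset.univ.val ↔ _
  constructor
  · intro hk
    have e (c : α) : Nonempty ({i // h i = c} ≃ {i // k i = c}) := by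
      refine Fintype.card_eq.1 ?_
      have hc := congrArg (Multiset.count c) hk
      simp only [Multiset.count_map, ← Finset.filter_val, ← Finset.card_def] at hc
      simpa only [Fintype.card_subtype, eq_comm] using hc
    exact ⟨Equiv.ofFiberEquiv fun c => (e c).some,
      funext fun i => (Equiv.ofFiberEquiv_map (fun c => (e c).some) i).symm⟩
  · rintro ⟨π, rfl⟩
    rw [← Multiset.map_map, Multiset.map_univ_val_equiv]

theorem symOfFn_surjective {α : Type*} {n : ℕ} :
    Function.Surjective (symOfFn : (Fin n → α) → Sym α n) := by
  rintro ⟨s, hs⟩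
  induction s using Quotient.inductionOn with
  | h l =>
    obtain rfl : l.length = n := hs
    refine ⟨l.get, Sym.coe_injective ?_⟩
    change Multiset.map l.get Finset.univ.val = (l : Multiset α)
    simp [Fin.univ_val_map]

/-- The matrix whose `(f, g)` entry is the value of `φ` at the unordered tuple of
pairs `(f i, g i)`. -/
def matrixOfSym (n d : ℕ) :
    (Sym (Fin d × Fin d) n → ℂ) →ₗ[ℂ] Matrix (Fin n → Fin d) (Fin n → Fin d) ℂ where
  toFun φ := Matrix.of fun f g => φ (symOfFn fun i => (f i, g i))
  map_add' _ _ := rfl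
  map_smul' _ _ := rfl

theorem matrixOfSym_injective (n d : ℕ) : Function.Injective (matrixOfSym n d) := by
  intro φ ψ h
  ext s
  obtain ⟨k, rfl⟩ := symOfFn_surjective s
  exact congrFun₂ h (fun i => (k i).1) (fun i => (k i).2)

theorem range_matrixOfSym (n d : ℕ) :
    LinearMap.range (matrixOfSym n d) = invariantMatrices n d := by
  ext M
  constructor
  · rintro ⟨φ, rfl⟩ π f g
    exact congrArg φ ((symOfFn_eq_iff _ _).2 ⟨π, rfl⟩)
  · intro hM
    refine ⟨fun s => M (fun i => (Function.surjInv symOfFn_surjective s i).1)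
      (fun i => (Function.surjInv symOfFn_surjective s i).2), ?_⟩
    ext f g
    obtain ⟨π, hπ⟩ := (symOfFn_eq_iff _ _).1
      (Function.surjInv_eq symOfFn_surjective (symOfFn fun i => (f i, g i)))
    rw [← hM π f g]
    exact congrArg₂ M (funext fun i => congrArg Prod.fst (congrFun hπ i))
      (funext fun i => congrArg Prod.snd (congrFun hπ i))

/-- For `d ≥ 1`, the space of `S_n`-invariant matrices indexed by `Fin n → Fin d` has
dimension exactly `C(n + d² − 1, d² − 1)`. -/
theorem finrank_invariantMatrices (n d : ℕ) (hd : 1 ≤ d) :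
    Module.finrank ℂ (invariantMatrices n d) = (n + d ^ 2 - 1).choose (d ^ 2 - 1) := by
  have hd2 : 1 ≤ d ^ 2 := Nat.one_le_pow _ _ hd
  rw [← range_matrixOfSym, LinearMap.finrank_range_of_inj (matrixOfSym_injective n d),
    Module.finrank_fintype_fun_eq_card, Sym.card_sym_eq_choose, Fintype.card_prod,
    Fintype.card_fin, ← sq, add_comm n]
  exact Nat.choose_symm_of_eq_add (by omega)
end

section
/- Let d_A, d_B, d_H, n be natural numbers. Consider matrices M over ℂ indexed by the set Fin d_A × (Fin n → Fin d_H) × Fin d_B, which are invariant under the symmetric group acting on the middle factor only, i.e., M ((a, f∘π, b), (a', g∘π, b')) = M ((a, f, b), (a', g, b')) for all permutations π of Fin n and all a, a', b, b', f, g. The ℂ-vector space of all such matrices has dimension at most d_A² · d_B² · (n+1)^{d_H²}. -/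
/-- The `ℂ`-subspace of matrices indexed by `Fin d_A × (Fin n → Fin d_H) × Fin d_B` that are
invariant under the symmetric group `S_n` acting on the middle factor only. -/
noncomputable def middleInvariantMatrices (dA dH dB n : ℕ) :
    Submodule ℂ (Matrix (Fin dA × (Fin n → Fin dH) × Fin dB)
      (Fin dA × (Fin n → Fin dH) × Fin dB) ℂ) where
  carrier := {M | ∀ (π : Equiv.Perm (Fin n)) (a a' : Fin dA) (b b' : Fin dB)
    (f g : Fin n → Fin dH), M (a, f ∘ π, b) (a', g ∘ π, b') = M (a, f, b) (a', g, b')}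
  add_mem' := by
    intro M N hM hN π a a' b b' f g
    simp only [Matrix.add_apply, hM π a a' b b' f g, hN π a a' b b' f g]
  zero_mem' := by
    intro π a a' b b' f g
    simp
  smul_mem' := by
    intro c M hM π a a' b b' f g
    simp only [Matrix.smul_apply, hM π a a' b b' f g]

/-- Two functions on a finite type whose fibers have the same cardinalities differ by a
permutation of the domain. -/
theorem exists_perm_comp_eq_of_card_fiber_eq {ι α : Type*} [Fintype ι] [DecidableEq α]
    {h k : ι → α} (hc : ∀ c, Fintype.card {i // h i = c} = Fintype.card {i // k i = c}) :
    ∃ π : Equiv.Perm ι, k ∘ π = h :=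
  ⟨Equiv.ofFiberEquiv fun c => Fintype.equivOfCardEq (hc c),
    funext fun i => Equiv.ofFiberEquiv_map _ i⟩

/-- A space of functions that are all constant on the fibers of a map `t : X → K` has dimension
at most the cardinality of `K`. -/
theorem finrank_le_card_of_constant_on_fibers {F X K : Type*} [Field F] [Fintype K]
    (t : X → K) (S : Submodule F (X → F))
    (hS : ∀ v ∈ S, ∀ x y, t x = t y → v x = v y) :
    Module.finrank F S ≤ Fintype.card K := by
  have hle : S ≤ LinearMap.range (LinearMap.funLeft F F t) := fun v hv =>
    ⟨Function.extend t v 0, funext fun x =>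
      Function.FactorsThrough.extend_apply (fun x y hxy => hS v hv x y hxy) 0 x⟩
  calc Module.finrank F S ≤ Module.finrank F (LinearMap.range (LinearMap.funLeft F F t)) :=
        Submodule.finrank_mono hle
    _ ≤ Module.finrank F (K → F) := LinearMap.finrank_range_le _
    _ = Fintype.card K := Module.finrank_fintype_fun_eq_card F

/-- The outer indices of a matrix position together with the number of occurrences of each pair
of middle letters. -/
def middleType {dA dH dB n : ℕ} (p : (Fin dA × (Fin n → Fin dH) × Fin dB) ×
    (Fin dA × (Fin n → Fin dH) × Fin dB)) :
    ((Fin dA × Fin dA) × (Fin dB × Fin dB)) × (Fin dH × Fin dH → Fin (n + 1)) :=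
  (((p.1.1, p.2.1), (p.1.2.2, p.2.2.2)), fun c =>
    ⟨Fintype.card {i // (p.1.2.1 i, p.2.2.1 i) = c},
      Nat.lt_succ_of_le ((Fintype.card_subtype_le _).trans_eq (Fintype.card_fin n))⟩)

theorem apply_eq_of_middleType_eq {dA dH dB n : ℕ}
    {M : Matrix (Fin dA × (Fin n → Fin dH) × Fin dB) (Fin dA × (Fin n → Fin dH) × Fin dB) ℂ}
    (hM : M ∈ middleInvariantMatrices dA dH dB n)
    {p q : (Fin dA × (Fin n → Fin dH) × Fin dB) × (Fin dA × (Fin n → Fin dH) × Fin dB)}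
    (hpq : middleType p = middleType q) : M p.1 p.2 = M q.1 q.2 := by
  obtain ⟨⟨a, f, b⟩, ⟨a', g, b'⟩⟩ := p
  obtain ⟨⟨c, f₁, d⟩, ⟨c', g₁, d'⟩⟩ := q
  simp only [middleType, Prod.mk.injEq] at hpq
  obtain ⟨⟨⟨rfl, rfl⟩, rfl, rfl⟩, hcard⟩ := hpq
  obtain ⟨π, hπ⟩ := exists_perm_comp_eq_of_card_fiber_eq
    (h := fun i => (f i, g i)) (k := fun i => (f₁ i, g₁ i))
    fun c => congrArg Fin.val (congrFun hcard c)
  have hf : f₁ ∘ π = f := funext fun i => congrArg Prod.fst (congrFun hπ i)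
  have hg : g₁ ∘ π = g := funext fun i => congrArg Prod.snd (congrFun hπ i)
  rw [← hf, ← hg]
  exact hM π a a' b b' f₁ g₁

/-- The space of matrices indexed by `Fin d_A × (Fin n → Fin d_H) × Fin d_B` invariant under
`S_n` acting on the middle factor has dimension at most `d_A² · d_B² · (n+1)^{d_H²}`. -/
theorem finrank_middleInvariantMatrices_le (dA dH dB n : ℕ) :
    Module.finrank ℂ (middleInvariantMatrices dA dH dB n) ≤
      dA ^ 2 * dB ^ 2 * (n + 1) ^ (dH ^ 2) := by
  let e := (LinearEquiv.curry ℂ ℂ (Fin dA × (Fin n → Fin dH) × Fin dB)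
    (Fin dA × (Fin n → Fin dH) × Fin dB)).symm
  have hle := finrank_le_card_of_constant_on_fibers middleType
    ((middleInvariantMatrices dA dH dB n).map e.toLinearMap) (by
      rintro _ ⟨M, hM, rfl⟩ p q hpq
      exact apply_eq_of_middleType_eq hM hpq)
  calc Module.finrank ℂ (middleInvariantMatrices dA dH dB n) = _ :=
        (LinearEquiv.finrank_map_eq e (middleInvariantMatrices dA dH dB n)).symm
    _ ≤ _ := hle
    _ = dA ^ 2 * dB ^ 2 * (n + 1) ^ (dH ^ 2) := by
        simp [sq]
end

section
/- Let X be a finite type, n ≥ 1, a : Fin n → X, and p ∈ X. Then n · |{x in the S_n-orbit of a : x ⟨n−1⟩ = p}| = |{v ∈ Fin n : a v = p}| · |S_n-orbit of a|, where ⟨n−1⟩ is the last element of Fin n. -/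
/-- In the orbit of `a` under permuting coordinates, the number of functions taking the value `p`
at a coordinate does not depend on the coordinate. -/
theorem card_orbit_fiber_eq {ι X : Type*} [Fintype ι] [DecidableEq ι] [DecidableEq X]
    (a : ι → X) (p : X) (i j : ι) :
    ((Finset.univ.image fun σ : Equiv.Perm ι => a ∘ σ).filter fun x => x i = p).card =
      ((Finset.univ.image fun σ : Equiv.Perm ι => a ∘ σ).filter fun x => x j = p).card := by
  refine Finset.card_nbij' (· ∘ Equiv.swap i j) (· ∘ Equiv.swap i j) ?_ ?_ ?_ ?_
  · intro x hx
    simp only [Finset.coe_filter, Finset.mem_image, Finset.mem_univ, true_and,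
      Set.mem_ofPred_eq] at hx ⊢
    obtain ⟨⟨σ, rfl⟩, h⟩ := hx
    exact ⟨⟨σ * Equiv.swap i j, rfl⟩, by simpa using h⟩
  · intro x hx
    simp only [Finset.coe_filter, Finset.mem_image, Finset.mem_univ, true_and,
      Set.mem_ofPred_eq] at hx ⊢
    obtain ⟨⟨σ, rfl⟩, h⟩ := hx
    exact ⟨⟨σ * Equiv.swap i j, rfl⟩, by simpa using h⟩
  · intro x _
    ext k
    simp
  · intro x _
    ext k
    simp

/-- Double counting of the pairs `(x, i)` with `x` in the orbit of `a` and `x i = p`. -/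
theorem card_mul_card_orbit_fiber {ι X : Type*} [Fintype ι] [DecidableEq ι] [DecidableEq X]
    (a : ι → X) (p : X) (j : ι) :
    Fintype.card ι *
        ((Finset.univ.image fun σ : Equiv.Perm ι => a ∘ σ).filter fun x => x j = p).card =
      (Finset.univ.filter fun v => a v = p).card *
        (Finset.univ.image fun σ : Equiv.Perm ι => a ∘ σ).card := by
  have h := Finset.sum_card_bipartiteAbove_eq_sum_card_bipartiteBelow
    (s := Finset.univ) (t := Finset.univ.image fun σ : Equiv.Perm ι => a ∘ σ)
    (fun (i : ι) (x : ι → X) => x i = p)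
  simp only [Finset.bipartiteAbove, Finset.bipartiteBelow] at h
  rw [Finset.sum_congr rfl fun i _ => card_orbit_fiber_eq a p i j, Finset.sum_const,
    Finset.card_univ, smul_eq_mul] at h
  rw [h, mul_comm, ← smul_eq_mul, ← Finset.sum_const]
  refine Finset.sum_congr rfl fun x hx => ?_
  obtain ⟨σ, -, rfl⟩ := Finset.mem_image.mp hx
  exact Finset.card_equiv σ fun i => by simp

/-- For `a : Fin n → X` with `n = m + 1 ≥ 1` and `p : X`, we have
`n · |{x in the orbit of a : x (last) = p}| = |{v : a v = p}| · |orbit of a|`. -/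
theorem card_orbit_fiber_last (X : Type*) [Fintype X] [DecidableEq X] (m : ℕ)
    (a : Fin (m + 1) → X) (p : X) :
    (m + 1) *
        Set.ncard {x : Fin (m + 1) → X |
          (∃ σ : Equiv.Perm (Fin (m + 1)), x = a ∘ σ) ∧ x (Fin.last m) = p} =
      (Finset.univ.filter fun v : Fin (m + 1) => a v = p).card *
        Set.ncard {x : Fin (m + 1) → X | ∃ σ : Equiv.Perm (Fin (m + 1)), x = a ∘ σ} := by
  have h := card_mul_card_orbit_fiber a p (Fin.last m)
  rw [Fintype.card_fin, ← Set.ncard_coe_finset, ← Set.ncard_coe_finset (Finset.image _ _)] at h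
  convert h using 3
  · ext x
    simp [eq_comm]
  · ext x
    simp [eq_comm]
end

section
/- Let n ≥ 1 and a, b : Fin n → Fin d, and let O be the orbit of the pair (a, b) under the diagonal action of S_n. (i) If a and b differ in at least two coordinates, then there is no pair (f, g) ∈ O with f v = g v for all v ≠ 0. (ii) If a and b differ in exactly one coordinate v₀, with α = a v₀ and β = b v₀ (so α ≠ β), then for all x, y ∈ Fin d, the number of pairs (f, g) ∈ O satisfying f 0 = x, g 0 = y, and f v = g v for all v ≠ 0 equals 0 when (x, y) ≠ (α, β), and equals (n−1)! / Π_{c ∈ Fin d} (|{v ∈ Fin n : v ≠ v₀ and a v = c}|)! when (x, y) = (α, β). -/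
/-- The number of rearrangements of `f`, times the product of the factorials of the fiber sizes
of `f`, is the factorial of the size of the domain. -/
theorem ncard_rearrangements_mul {α ι : Type*} [Finite α] [Fintype ι] (f : α → ι) :
    {g : α → ι | ∃ σ : Equiv.Perm α, g = f ∘ σ}.ncard * ∏ c, {v | f v = c}.ncard.factorial =
      (Nat.card α).factorial := by
  have horbit : {g : α → ι | ∃ σ : Equiv.Perm α, g = f ∘ σ} =
      MulAction.orbit (Equiv.Perm α)ᵈᵐᵃ f := by
    ext g
    exact ⟨fun ⟨σ, h⟩ => ⟨DomMulAct.mk σ, h.symm⟩,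
      fun ⟨σ, h⟩ => ⟨DomMulAct.mk.symm σ, h.symm⟩⟩
  have hstab : Nat.card (MulAction.stabilizer (Equiv.Perm α)ᵈᵐᵃ f) =
      ∏ c, {v | f v = c}.ncard.factorial := by
    rw [← DomMulAct.stabilizer_ncard f, ← Nat.card_coe_set_eq]
    exact Nat.card_congr (DomMulAct.mk.symm.subtypeEquiv fun _ => DomMulAct.mem_stabilizer_iff)
  rw [horbit, ← hstab, ← MulAction.index_stabilizer, Subgroup.index_mul_card,
    Nat.card_congr DomMulAct.mk.symm, Nat.card_perm]

theorem exists_perm_zero_succAbove {m : ℕ} (v₀ : Fin (m + 1)) (τ : Equiv.Perm (Fin m)) :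
    ∃ σ : Equiv.Perm (Fin (m + 1)), σ 0 = v₀ ∧ ∀ i, σ i.succ = v₀.succAbove (τ i) :=
  ⟨(finSuccEquiv m).trans ((Equiv.optionCongr τ).trans (finSuccEquiv' v₀).symm),
    by simp, by simp⟩

theorem exists_perm_succAbove_of_zero {m : ℕ} {v₀ : Fin (m + 1)} {σ : Equiv.Perm (Fin (m + 1))}
    (h : σ 0 = v₀) : ∃ τ : Equiv.Perm (Fin m), ∀ i, σ i.succ = v₀.succAbove (τ i) := by
  refine ⟨(finSuccAboveEquiv 0).trans ((σ.subtypeEquiv fun v => ?_).trans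
    (finSuccAboveEquiv v₀).symm), fun i => ?_⟩
  · rw [← h, σ.injective.ne_iff]
  · have key := fun x => congrArg Subtype.val ((finSuccAboveEquiv v₀).apply_symm_apply x)
    simp only [finSuccAboveEquiv_apply] at key
    simp [key, finSuccAboveEquiv_apply]

/-- Partial trace, over all tensor factors except the first, of a 0–1 orbit matrix, where
`O` is the orbit of `(a, b)` under the diagonal `S_n`-action (`n = m + 1 ≥ 1`).
(i) If `a` and `b` differ in at least two coordinates, there is no pair `(f, g) ∈ O` with
`f v = g v` for all `v ≠ 0`.
(ii) If `a` and `b` differ in exactly one coordinate `v₀`, then for all `x y : Fin d`, the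
number of pairs `(f, g) ∈ O` with `f 0 = x`, `g 0 = y` and `f v = g v` for all `v ≠ 0` is
`(n−1)! / Π_c |{v ≠ v₀ : a v = c}|!` when `(x, y) = (a v₀, b v₀)`, and `0` otherwise. -/
theorem orbit_partial_trace_count (d m : ℕ) (a b : Fin (m + 1) → Fin d) :
    (2 ≤ (Finset.univ.filter fun v : Fin (m + 1) => a v ≠ b v).card →
      ¬∃ f g : Fin (m + 1) → Fin d,
        (∃ σ : Equiv.Perm (Fin (m + 1)), f = a ∘ σ ∧ g = b ∘ σ) ∧
          ∀ v : Fin (m + 1), v ≠ 0 → f v = g v) ∧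
    (∀ v₀ : Fin (m + 1),
      (Finset.univ.filter fun v : Fin (m + 1) => a v ≠ b v) = {v₀} →
      ∀ x y : Fin d,
        Set.ncard {fg : (Fin (m + 1) → Fin d) × (Fin (m + 1) → Fin d) |
            (∃ σ : Equiv.Perm (Fin (m + 1)), fg.1 = a ∘ σ ∧ fg.2 = b ∘ σ) ∧
              fg.1 0 = x ∧ fg.2 0 = y ∧ ∀ v : Fin (m + 1), v ≠ 0 → fg.1 v = fg.2 v} =
          if x = a v₀ ∧ y = b v₀ then
            m.factorial /
              ∏ c : Fin d,
                (Finset.univ.filter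
                  fun v : Fin (m + 1) => v ≠ v₀ ∧ a v = c).card.factorial
          else 0) := by
  refine ⟨?_, fun v₀ hv₀ x y => ?_⟩
  · rintro hcard ⟨_, _, ⟨σ, rfl, rfl⟩, h⟩
    refine hcard.not_gt (Nat.lt_succ_of_le ?_)
    refine (Finset.card_le_card fun v hv => ?_).trans (Finset.card_singleton (σ 0)).le
    by_contra hne
    refine (Finset.mem_filter.1 hv).2 ?_
    simpa using h (σ.symm v) fun h0 => hne (by simp [← h0])
  have hdiff : ∀ v, a v ≠ b v ↔ v = v₀ := fun v => by
    simpa using Finset.ext_iff.1 hv₀ v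
  have hzero : ∀ σ : Equiv.Perm (Fin (m + 1)),
      (∀ v, v ≠ 0 → (a ∘ σ) v = (b ∘ σ) v) → σ 0 = v₀ := fun σ h => by
    by_contra hne
    refine (hdiff v₀).2 rfl ?_
    simpa using h (σ.symm v₀) fun h0 => hne (by simp [← h0])
  split_ifs with hxy
  · obtain ⟨rfl, rfl⟩ := hxy
    have himage : {fg : (Fin (m + 1) → Fin d) × (Fin (m + 1) → Fin d) |
        (∃ σ : Equiv.Perm (Fin (m + 1)), fg.1 = a ∘ σ ∧ fg.2 = b ∘ σ) ∧
          fg.1 0 = a v₀ ∧ fg.2 0 = b v₀ ∧ ∀ v : Fin (m + 1), v ≠ 0 → fg.1 v = fg.2 v} =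
        (fun k : Fin m → Fin d => ((Fin.cons (a v₀) k : Fin (m + 1) → Fin d),
          (Fin.cons (b v₀) k : Fin (m + 1) → Fin d))) ''
          {k | ∃ τ : Equiv.Perm (Fin m), k = (a ∘ v₀.succAbove) ∘ τ} := by
      have hab : ∀ i, b (v₀.succAbove i) = a (v₀.succAbove i) := fun i =>
        (not_not.1 fun h => v₀.succAbove_ne i ((hdiff _).1 h)).symm
      ext ⟨f, g⟩
      constructor
      · rintro ⟨⟨σ, rfl, rfl⟩, -, -, h⟩
        have h0 := hzero σ h
        obtain ⟨τ, hτ⟩ := exists_perm_succAbove_of_zero h0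
        refine ⟨_, ⟨τ, rfl⟩, Prod.ext ?_ ?_⟩ <;>
        · funext v
          cases v using Fin.cases <;> simp [h0, hτ, hab]
      · rintro ⟨_, ⟨τ, rfl⟩, h⟩
        obtain ⟨rfl, rfl⟩ := Prod.ext_iff.1 h
        obtain ⟨σ, h0, hσ⟩ := exists_perm_zero_succAbove v₀ τ
        refine ⟨⟨σ, ?_, ?_⟩, rfl, rfl, fun v hv => ?_⟩
        · funext v
          cases v using Fin.cases <;> simp [h0, hσ]
        · funext v
          cases v using Fin.cases <;> simp [h0, hσ, hab]
        · obtain ⟨i, rfl⟩ := Fin.exists_succ_eq.2 hv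
          simp
    have hfiber : ∀ c, {i | (a ∘ v₀.succAbove) i = c}.ncard =
        (Finset.univ.filter fun v : Fin (m + 1) => v ≠ v₀ ∧ a v = c).card := fun c => by
      rw [← Set.ncard_image_of_injective _ (Fin.succAbove_right_injective (p := v₀)),
        ← Set.ncard_coe_finset]
      congr 1
      ext v
      simp only [Set.mem_image, Set.mem_ofPred_eq, Function.comp_apply, Finset.coe_filter,
        Finset.mem_univ, true_and]
      constructor
      · rintro ⟨i, hi, rfl⟩
        exact ⟨v₀.succAbove_ne i, hi⟩
      · rintro ⟨hne, hv⟩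
        obtain ⟨i, rfl⟩ := Fin.exists_succAbove_eq hne
        exact ⟨i, hv, rfl⟩
    have hinj : Function.Injective fun k : Fin m → Fin d =>
        ((Fin.cons (a v₀) k : Fin (m + 1) → Fin d),
          (Fin.cons (b v₀) k : Fin (m + 1) → Fin d)) := fun k l h =>
      Fin.cons_right_injective (α := fun _ => Fin d) _ (congrArg Prod.fst h)
    have hcount := ncard_rearrangements_mul (a ∘ v₀.succAbove)
    simp only [hfiber, Nat.card_fin] at hcount
    rw [himage, Set.ncard_image_of_injective _ hinj, ← hcount,
      Nat.mul_div_cancel _ (Finset.prod_pos fun _ _ => Nat.factorial_pos _)]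
  · rw [Set.ncard_eq_zero]
    refine Set.eq_empty_of_forall_notMem ?_
    rintro ⟨_, _⟩ ⟨⟨σ, rfl, rfl⟩, hx, hy, h⟩
    have h0 := hzero σ h
    exact hxy ⟨by simpa [h0] using hx.symm, by simpa [h0] using hy.symm⟩
end
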